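/- arXiv:2010.10151 — 3 statements merged into one kernel-verified Lean document; each statement's English description precedes it below -/
import Mathlib

section
/- Threshold coherence of MCM: for every threshold t ∈ ℝ and all classes A, B with A ≼ B, if MCM_A ≥ t then MCM_B ≥ t; equivalently, for any threshold the set of classes predicted by C-HMCNN(h) (those A with MCM_A ≥ t) is closed under superclasses, so the predictions are coherent with the hierarchy constraint independently of the chosen threshold. -/
/-- The max constraint module: `MCM h A` is the maximum of the outputs `h B`
over all subclasses `B` of `A` (i.e., all `B` with `B ≤ A`). -/
noncomputable def MCM {S : Type*} [Fintype S] [Preorder S]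
    [DecidableRel (fun a b : S => a ≤ b)] (h : S → ℝ) (A : S) : ℝ :=
  (Finset.univ.filter (fun B => B ≤ A)).sup' ⟨A, by simp⟩ h

/-- Threshold coherence: for every threshold `t`, if `A ≤ B` and `A` is
predicted (`MCM h A ≥ t`), then `B` is predicted as well. -/
theorem mcm_threshold_coherent {S : Type*} [Fintype S] [Preorder S]
    [DecidableRel (fun a b : S => a ≤ b)] (h : S → ℝ) :
    ∀ t : ℝ, ∀ A B : S, A ≤ B → t ≤ MCM h A → t ≤ MCM h B := by
  intro t A B hAB ht
  refine ht.trans (Finset.sup'_mono h (fun C hC => ?_) _)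
  simp only [Finset.mem_filter, Finset.mem_univ, true_and] at hC ⊢
  exact hC.trans hAB
end

section
/- In the basic two-class case, the max constraint loss coincides with the standard binary cross-entropy loss except in exactly one situation: MCLoss = ℒ if and only if it is not the case that y_A = 0, y_B = 1 and h_A > h_B; in particular, if y_A = 0, y_B = 1 and h_A > h_B then MCLoss ≠ ℒ. -/
open Real in
/-- In the basic two-class case (`A` a subclass of `B`), the max constraint
loss coincides with the standard binary cross-entropy loss iff it is not the
case that `y_A = 0`, `y_B = 1` and `h_A > h_B`. -/
theorem mcloss_eq_bce_iff (hA hB yA yB : ℝ)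
    (hA0 : 0 < hA) (hA1 : hA < 1) (hB0 : 0 < hB) (hB1 : hB < 1)
    (hyA : yA = 0 ∨ yA = 1) (hyB : yB = 0 ∨ yB = 1) :
    let MCMA : ℝ := hA
    let MCMB : ℝ := max hB hA
    let MCLoss : ℝ :=
      (-yA * log MCMA - (1 - yA) * log (1 - MCMA)) +
        (-yB * log (max hB (hA * yA)) - (1 - yB) * log (1 - MCMB))
    let L : ℝ :=
      -yA * log MCMA - (1 - yA) * log (1 - MCMA)
        - yB * log MCMB - (1 - yB) * log (1 - MCMB)
    (MCLoss = L ↔ ¬ (yA = 0 ∧ yB = 1 ∧ hB < hA)) ∧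
      ((yA = 0 ∧ yB = 1 ∧ hB < hA) → MCLoss ≠ L) := by
  intro MCMA MCMB MCLoss L
  have diff : MCLoss - L = yB * (log (max hB hA) - log (max hB (hA * yA))) := by
    simp only [MCLoss, L, MCMA, MCMB]
    ring
  have key : MCLoss = L ↔ ¬ (yA = 0 ∧ yB = 1 ∧ hB < hA) := by
    rw [← sub_eq_zero, diff]
    rcases hyB with rfl | rfl
    · simp
    rcases hyA with rfl | rfl
    · rcases lt_or_ge hB hA with h | h
      · have hlog : log hB < log hA := log_lt_log hB0 h
        simp [max_eq_right h.le, max_eq_left hB0.le, h, sub_ne_zero.mpr hlog.ne']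
      · simp [max_eq_left hB0.le, h]
    · simp
  exact ⟨key, fun h e => key.mp e h⟩
end

section
/- Correctness of the masked (GPU) computation of MCLoss: let M : S × S → ℝ be the mask with M_{A,B} = 1 if B ≼ A and M_{A,B} = 0 otherwise, assume 0 ≤ h_B for every class B and y_B ∈ {0,1} for every class B, and define for each class A the combined prediction p_A = (1-y_A)·MCM_A + y_A·max_{B∈S}(M_{A,B}·y_B·h_B). Then for every class A, the binary cross-entropy term -y_A·ln(p_A) - (1-y_A)·ln(1-p_A) equals MCLoss_A, and hence the binary cross-entropy loss of p against y equals MCLoss. -/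
/-- The maximum of a masked nonnegative function over a whole finite type is its maximum over
the unmasked elements. -/
theorem sup'_univ_mask_mul_eq_sup'_filter {S : Type*} [Fintype S] (P : S → Prop)
    [DecidablePred P] {f : S → ℝ} (hf : ∀ B, 0 ≤ f B) (hu : (Finset.univ : Finset S).Nonempty)
    (hP : (Finset.univ.filter P).Nonempty) :
    Finset.univ.sup' hu (fun B => (if P B then 1 else 0) * f B) =
      (Finset.univ.filter P).sup' hP f := by
  apply le_antisymm
  · refine Finset.sup'_le _ _ fun B _ => ?_
    by_cases hB : P B
    · exact Finset.le_sup'_of_le _ (Finset.mem_filter.2 ⟨Finset.mem_univ B, hB⟩) (by simp [hB])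
    · obtain ⟨C, hC⟩ := hP
      exact Finset.le_sup'_of_le _ hC (by simp [hB, hf C])
  · refine Finset.sup'_le _ _ fun B hB => ?_
    exact Finset.le_sup'_of_le _ (Finset.mem_univ B) (by simp [(Finset.mem_filter.1 hB).2])

open Real in
/-- Correctness of the masked (GPU) computation of `MCLoss`: with the 0/1 mask
`M A B = 1` iff `B ≤ A`, nonnegative outputs `h` and 0/1 labels `y`, the
binary cross-entropy of the combined prediction
`p A = (1 - y A)·MCM h A + y A·max_B (M A B · y B · h B)` against `y` equals
the max constraint loss, termwise and in total. -/
theorem masked_mcloss_correct {S : Type*} [Fintype S] [Preorder S]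
    [DecidableRel (fun a b : S => a ≤ b)] (h y : S → ℝ)
    (hpos : ∀ B : S, 0 ≤ h B) (hy : ∀ B : S, y B = 0 ∨ y B = 1)
    (M : S → S → ℝ) (hM : ∀ A B : S, M A B = if B ≤ A then 1 else 0) :
    let p : S → ℝ := fun A =>
      (1 - y A) * MCM h A +
        y A * Finset.univ.sup' ⟨A, Finset.mem_univ A⟩
          (fun B => M A B * y B * h B)
    let MCLossA : S → ℝ := fun A =>
      -y A * log ((Finset.univ.filter (fun B => B ≤ A)).sup' ⟨A, by simp⟩
            (fun B => y B * h B))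
        - (1 - y A) * log (1 - MCM h A)
    (∀ A : S, -y A * log (p A) - (1 - y A) * log (1 - p A) = MCLossA A) ∧
      (∑ A : S, (-y A * log (p A) - (1 - y A) * log (1 - p A)))
        = ∑ A : S, MCLossA A := by
  intro p MCLossA
  have hterm (A : S) :
      -y A * log (p A) - (1 - y A) * log (1 - p A) = MCLossA A := by
    have hyh (B : S) : 0 ≤ y B * h B := by
      rcases hy B with hB | hB <;> simp [hB, hpos B]
    have hmax := sup'_univ_mask_mul_eq_sup'_filter (fun B => B ≤ A) hyh
      ⟨A, Finset.mem_univ A⟩ ⟨A, by simp⟩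
    rcases hy A with hA | hA
    · simp [p, MCLossA, hA]
    · simp only [p, MCLossA, hA, hM, mul_assoc, hmax]
      simp
  exact ⟨hterm, Finset.sum_congr rfl fun A _ => hterm A⟩
end
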